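/- arXiv:1510.08878 — 2 statements merged into one kernel-verified Lean document; each statement's English description precedes it below -/
import Mathlib

section
/- If a < b ≤ -1, then the convex-polynomials are dense in C(a,b) with the topology of uniform convergence on compact subsets of (a,b): for every continuous function f : (a,b) → ℝ, every compact set K ⊆ (a,b), and every ε > 0, there exists a convex-polynomial p such that |p(x) - f(x)| < ε for all x ∈ K. -/
/-- A convex-polynomial: all coefficients nonnegative and they sum to 1
(equivalently, `p.eval 1 = 1`). -/
def IsConvexPolynomial (p : Polynomial ℝ) : Prop :=
  (∀ n : ℕ, 0 ≤ p.coeff n) ∧ p.eval 1 = 1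

/-- nonnegative coefficients -/
def NNP (p : Polynomial ℝ) : Prop := ∀ n, 0 ≤ p.coeff n

lemma NNP.add {p q : Polynomial ℝ} (hp : NNP p) (hq : NNP q) : NNP (p + q) := by
  intro n; rw [Polynomial.coeff_add]; exact add_nonneg (hp n) (hq n)

lemma NNP.mul {p q : Polynomial ℝ} (hp : NNP p) (hq : NNP q) : NNP (p * q) := by
  intro n; rw [Polynomial.coeff_mul]
  exact Finset.sum_nonneg fun i _ => mul_nonneg (hp _) (hq _)

lemma NNP.monomial (n : ℕ) {a : ℝ} (ha : 0 ≤ a) : NNP (Polynomial.monomial n a) := by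
  intro m; rw [Polynomial.coeff_monomial]; split_ifs <;> simp [ha]

lemma NNP.eval_one {p : Polynomial ℝ} (hp : NNP p) : 0 ≤ p.eval 1 := by
  rw [Polynomial.eval_eq_sum_range]
  exact Finset.sum_nonneg fun i _ => by simpa using hp i

/-- approximable on `K` by nonnegative polynomials with coefficient sum at most `c` -/
def Apx (K : Set ℝ) (g : ℝ → ℝ) (c : ℝ) : Prop :=
  ∀ ε > 0, ∃ p : Polynomial ℝ, NNP p ∧ p.eval 1 ≤ c ∧ ∀ x ∈ K, |p.eval x - g x| ≤ ε

lemma Apx.mul {K : Set ℝ} {g h : ℝ → ℝ} {c d B : ℝ} (hg : Apx K g c) (hh : Apx K h d)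
    (bg : ∀ x ∈ K, |g x| ≤ B) (bh : ∀ x ∈ K, |h x| ≤ B) :
    Apx K (fun x => g x * h x) (c * d) := by
  intro ε hε
  set η := min 1 (ε / (2 * |B| + 1)) with hη
  have hη0 : 0 < η := by positivity
  obtain ⟨p, hp, hp1, hpx⟩ := hg η hη0
  obtain ⟨q, hq, hq1, hqx⟩ := hh η hη0
  refine ⟨p * q, hp.mul hq, ?_, ?_⟩
  · rw [Polynomial.eval_mul]
    exact mul_le_mul hp1 hq1 hq.eval_one (hp.eval_one.trans hp1)
  · intro x hx
    rw [Polynomial.eval_mul]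
    have e : p.eval x * q.eval x - g x * h x
      = (p.eval x - g x) * (q.eval x - h x) + (p.eval x - g x) * h x
        + g x * (q.eval x - h x) := by ring
    have h1 := hpx x hx
    have h2 := hqx x hx
    have h3 := (bg x hx).trans (le_abs_self B)
    have h4 := (bh x hx).trans (le_abs_self B)
    have h5 : η ≤ 1 := min_le_left _ _
    have h6 : η * (2 * |B| + 1) ≤ ε := by
      rw [← le_div_iff₀ (by positivity)]; exact min_le_right _ _
    calc _ ≤ |(p.eval x - g x) * (q.eval x - h x)| + |(p.eval x - g x) * h x|
        + |g x * (q.eval x - h x)| := by rw [e]; exact abs_add_three _ _ _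
      _ ≤ η * 1 + η * |B| + |B| * η := by
        simp only [abs_mul]
        gcongr
        exact h2.trans h5
      _ ≤ ε := by linarith

lemma apx_series {C : ℝ} (hC : 1 ≤ C) (a : ℕ → ℝ) (ha : ∀ n, 0 ≤ a n)
    (hs : Summable fun n => a n * C ^ n) :
    Apx (Set.Icc (-C) C) (fun x => ∑' n, a n * x ^ n) (∑' n, a n) := by
  intro ε hε
  have hs1 : Summable a := by
    refine Summable.of_nonneg_of_le ha (fun n => ?_) hs
    exact le_mul_of_one_le_right (ha n) (one_le_pow₀ hC)
  have hu := tendstoUniformlyOn_tsum_nat (f := fun n (x : ℝ) => a n * x ^ n) hs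
    (s := Set.Icc (-C) C) (by
      intro n x hx
      rw [Real.norm_eq_abs, abs_mul, abs_of_nonneg (ha n), abs_pow]
      have := abs_le.2 hx
      gcongr
      exact ha n)
  rw [Metric.tendstoUniformlyOn_iff] at hu
  obtain ⟨N, hN⟩ := (hu ε hε).exists
  refine ⟨∑ n ∈ Finset.range N, Polynomial.monomial n (a n), ?_, ?_, ?_⟩
  · intro m
    rw [Polynomial.finsetSum_coeff]
    exact Finset.sum_nonneg fun i _ => NNP.monomial i (ha i) m
  · rw [Polynomial.eval_finsetSum]
    simp only [Polynomial.eval_monomial, one_pow, mul_one]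
    exact hs1.sum_le_tsum _ (fun i _ => ha i)
  · intro x hx
    rw [Polynomial.eval_finsetSum]
    simp only [Polynomial.eval_monomial]
    have := hN x hx
    rw [dist_comm, Real.dist_eq] at this
    exact this.le

lemma hs_exp (y : ℝ) : HasSum (fun n : ℕ => y ^ n / (n.factorial : ℝ)) (Real.exp y) := by
  rw [Real.exp_eq_exp_ℝ]; exact NormedSpace.expSeries_div_hasSum_exp y

/-- odd coefficient selector -/
noncomputable def oc (n : ℕ) : ℝ := (1 - (-1) ^ n) / 2

lemma oc_nonneg (n : ℕ) : 0 ≤ oc n := by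
  unfold oc; rcases neg_one_pow_eq_or ℝ n with h | h <;> rw [h] <;> norm_num

lemma oc_le (n : ℕ) : oc n ≤ 1 := by
  unfold oc; rcases neg_one_pow_eq_or ℝ n with h | h <;> rw [h] <;> norm_num

lemma oc_neg (n : ℕ) : oc n * (-1) ^ n = - oc n := by
  unfold oc; rcases neg_one_pow_eq_or ℝ n with h | h <;> rw [h] <;> norm_num

/-- tail coefficients -/
noncomputable def ac (L n : ℕ) : ℝ := if 6 * L ≤ n then oc n * ((L : ℝ) ^ n / n.factorial) else 0

lemma ac_nonneg (L n : ℕ) : 0 ≤ ac L n := by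
  unfold ac; split_ifs
  · exact mul_nonneg (oc_nonneg n) (by positivity)
  · exact le_rfl

lemma ac_le (L n : ℕ) : ac L n ≤ (L : ℝ) ^ n / n.factorial := by
  unfold ac; split_ifs
  · exact mul_le_of_le_one_left (by positivity) (oc_le n)
  · positivity

lemma ac_sum (L : ℕ) : ∑' n, ac L n ≤ Real.exp (-(6 * L)) * Real.exp (L * Real.exp 1) := by
  have h := (hs_exp (L * Real.exp 1)).mul_left (Real.exp (-(6 * L)))
  have hle : ∀ n, ac L n ≤
      Real.exp (-(6 * L)) * ((L * Real.exp 1) ^ n / (n.factorial : ℝ)) := by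
    intro n
    by_cases hn : 6 * L ≤ n
    · refine (ac_le L n).trans ?_
      rw [mul_pow, ← Real.exp_nat_mul, mul_one]
      have : 1 ≤ Real.exp (-(6 * L)) * Real.exp n := by
        rw [← Real.exp_add, Real.one_le_exp_iff]
        have : (6 * L : ℝ) ≤ n := by exact_mod_cast hn
        linarith
      have h2 : 0 ≤ (L : ℝ) ^ n / n.factorial := by positivity
      calc _ ≤ (L : ℝ) ^ n / n.factorial * (Real.exp (-(6 * L)) * Real.exp n) :=
            le_mul_of_one_le_right h2 this
        _ = _ := by ring
    · have : ac L n = 0 := by simp [ac, hn]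
      rw [this]; positivity
  rw [← h.tsum_eq]
  exact (Summable.of_nonneg_of_le (ac_nonneg L) hle h.summable).tsum_le_tsum hle h.summable

lemma ac_val (L : ℕ) (s : ℝ) (hs : 20 ≤ s) :
    |Real.exp (L * -s) * ∑' n, ac L n * (-s) ^ n + 1 / 2| ≤ 2 * Real.exp (-L) := by
  have hs0 : 0 < s := by linarith
  set b : ℕ → ℝ := fun n => oc n * ((L * s) ^ n / n.factorial) - ac L n * s ^ n with hb
  have hodd : HasSum (fun n => oc n * ((L * s) ^ n / (n.factorial : ℝ)))
      ((Real.exp (L * s) - Real.exp (-(L * s))) / 2) := by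
    have h0 := ((hs_exp (L * s)).sub (hs_exp (-(L * s)))).div_const 2
    have he : (fun n => oc n * ((L * s) ^ n / (n.factorial : ℝ))) = fun n : ℕ =>
        ((L * s) ^ n / (n.factorial : ℝ) - (-(L * s)) ^ n / (n.factorial : ℝ)) / 2 := by
      funext n
      rw [neg_pow (L * s)]; unfold oc; ring
    rw [he]; exact h0
  have hac : ∀ n, ac L n * s ^ n = if 6 * L ≤ n then oc n * ((L * s) ^ n / n.factorial) else 0 := by
    intro n; unfold ac; split_ifs
    · rw [mul_pow]; ring
    · simp
  have hterm : ∀ n, 0 ≤ oc n * ((L * s) ^ n / (n.factorial : ℝ)) := fun n =>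
    mul_nonneg (oc_nonneg n) (by positivity)
  have hb0 : ∀ n, 0 ≤ b n := by
    intro n; simp only [hb, hac]; split_ifs
    · simp
    · simpa using hterm n
  have h := (hs_exp (L * s * Real.exp (-1))).mul_left (Real.exp (6 * L))
  have hble : ∀ n, b n ≤ Real.exp (6 * L) * ((L * s * Real.exp (-1)) ^ n / (n.factorial : ℝ)) := by
    intro n; simp only [hb, hac]; split_ifs with hn
    · rw [sub_self]; positivity
    · rw [sub_zero, mul_pow (L * s), ← Real.exp_nat_mul]
      have h1 : 1 ≤ Real.exp (6 * L) * Real.exp (n * -1) := by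
        rw [← Real.exp_add, Real.one_le_exp_iff]
        have : (n : ℝ) ≤ 6 * L := by exact_mod_cast (not_le.1 hn).le
        linarith
      have h2 : 0 ≤ (L * s) ^ n / (n.factorial : ℝ) := by positivity
      calc _ ≤ (L * s) ^ n / (n.factorial : ℝ) := mul_le_of_le_one_left h2 (oc_le n)
        _ ≤ (L * s) ^ n / (n.factorial : ℝ) * (Real.exp (6 * L) * Real.exp (n * -1)) :=
            le_mul_of_one_le_right h2 h1
        _ = _ := by ring
  have hbs : Summable b := Summable.of_nonneg_of_le hb0 hble h.summable
  have hbt : ∑' n, b n ≤ Real.exp (6 * L) * Real.exp (L * s * Real.exp (-1)) := by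
    rw [← h.tsum_eq]; exact hbs.tsum_le_tsum hble h.summable
  have hbt0 : 0 ≤ ∑' n, b n := tsum_nonneg hb0
  have hneg : ∀ n, ac L n * (-s) ^ n = b n - oc n * ((L * s) ^ n / (n.factorial : ℝ)) := by
    intro n
    simp only [hb]
    have : ac L n * (-1) ^ n = - ac L n := by
      unfold ac; split_ifs
      · have := oc_neg n
        linear_combination ((L : ℝ) ^ n / n.factorial) * this
      · simp
    rw [neg_pow s]
    linear_combination s ^ n * this
  have hval : ∑' n, ac L n * (-s) ^ n
      = ∑' n, b n - (Real.exp (L * s) - Real.exp (-(L * s))) / 2 := by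
    rw [← hodd.tsum_eq, ← hbs.tsum_sub hodd.summable]
    exact tsum_congr hneg
  rw [hval]
  have he : Real.exp (L * -s) * Real.exp (L * s) = 1 := by
    rw [← Real.exp_add]; simp
  have e1 : Real.exp (L * -s) * (∑' n, b n - (Real.exp (L * s) - Real.exp (-(L * s))) / 2) + 1 / 2
      = Real.exp (L * -s) * ∑' n, b n + Real.exp (L * -s) * Real.exp (-(L * s)) / 2 := by
    linear_combination (-1 / 2) * he
  have hL : (0 : ℝ) ≤ L := Nat.cast_nonneg L
  have hLs : (L : ℝ) * 20 ≤ L * s := by gcongr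
  have h3 : Real.exp (L * -s) * ∑' n, b n ≤ Real.exp (-L) := by
    calc _ ≤ Real.exp (L * -s) * (Real.exp (6 * L) * Real.exp (L * s * Real.exp (-1))) := by gcongr
      _ ≤ _ := by
        rw [← Real.exp_add, ← Real.exp_add, Real.exp_le_exp]
        have : Real.exp (-1) ≤ 1 / 2 := by
          have := Real.exp_neg_one_lt_d9; linarith
        have : L * s * Real.exp (-1) ≤ L * s * (1 / 2) := by gcongr
        linarith
  have h4 : Real.exp (L * -s) * Real.exp (-(L * s)) ≤ Real.exp (-L) := by
    rw [← Real.exp_add, Real.exp_le_exp]; linarith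
  have h5 := Real.exp_pos (-(L : ℝ))
  rw [e1, abs_of_nonneg (by positivity)]
  linarith

/-- approximable with arbitrarily small coefficient sum -/
def Sm (K : Set ℝ) (g : ℝ → ℝ) : Prop :=
  ∀ ε > 0, ∃ p : Polynomial ℝ, NNP p ∧ p.eval 1 ≤ ε ∧ ∀ x ∈ K, |p.eval x - g x| ≤ ε

lemma sm_half (C : ℝ) (hC : 20 ≤ C) : Sm (Set.Icc (-C) (-20)) (fun _ => -(1 / 2)) := by
  intro ε hε
  obtain ⟨L, hL⟩ : ∃ L : ℕ, 3 * Real.exp (-L) ≤ ε := by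
    have : Filter.Tendsto (fun L : ℕ => 3 * Real.exp (-(L : ℝ))) Filter.atTop (nhds (3 * 0)) :=
      (Real.tendsto_exp_neg_atTop_nhds_zero.comp tendsto_natCast_atTop_atTop).const_mul 3
    rw [mul_zero] at this
    obtain ⟨L, hL⟩ := (this.eventually (gt_mem_nhds hε)).exists
    exact ⟨L, hL.le⟩
  have hC0 : 0 ≤ C := by linarith
  have hLp := Real.exp_pos (-(L : ℝ))
  have A1 := apx_series (C := C) (by linarith) (fun n => (L : ℝ) ^ n / n.factorial)
    (fun n => by positivity) (by
      convert (hs_exp (L * C)).summable using 2 with n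
      rw [mul_pow]; ring)
  have A2 := apx_series (C := C) (by linarith) (ac L) (ac_nonneg L) (by
      refine Summable.of_nonneg_of_le (fun n => mul_nonneg (ac_nonneg L n) (by positivity))
        (fun n => ?_) (hs_exp (L * C)).summable
      rw [mul_pow, mul_div_right_comm]
      gcongr
      exact ac_le L n)
  have E1 : ∀ x : ℝ, ∑' n : ℕ, (L : ℝ) ^ n / n.factorial * x ^ n = Real.exp (L * x) := by
    intro x
    rw [← (hs_exp (L * x)).tsum_eq]
    refine tsum_congr fun n => ?_
    rw [mul_pow]; ring
  have E2 : ∑' n : ℕ, (L : ℝ) ^ n / n.factorial = Real.exp L := (hs_exp L).tsum_eq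
  simp only [E1] at A1
  rw [E2] at A1
  have hsub : Set.Icc (-C) (-20) ⊆ Set.Icc (-C) C := Set.Icc_subset_Icc le_rfl (by linarith)
  have S2 : Summable fun n => ac L n * C ^ n := by
      refine Summable.of_nonneg_of_le (fun n => mul_nonneg (ac_nonneg L n) (by positivity))
        (fun n => ?_) (hs_exp (L * C)).summable
      rw [mul_pow, mul_div_right_comm]
      gcongr
      exact ac_le L n
  have A := Apx.mul (B := max (Real.exp (L * C)) (∑' n, ac L n * C ^ n)) A1 A2 (by
      intro x hx
      refine le_trans ?_ (le_max_left _ _)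
      rw [abs_of_pos (Real.exp_pos _), Real.exp_le_exp]
      have := hx.2
      gcongr) (by
      intro x hx
      refine le_trans ?_ (le_max_right _ _)
      rw [← Real.norm_eq_abs]
      refine tsum_of_norm_bounded S2.hasSum fun n => ?_
      rw [Real.norm_eq_abs, abs_mul, abs_of_nonneg (ac_nonneg L n), abs_pow]
      have := abs_le.2 hx
      gcongr
      exact ac_nonneg L n)
  obtain ⟨p, hp, hp1, hpx⟩ := A (Real.exp (-L)) hLp
  refine ⟨p, hp, ?_, ?_⟩
  · refine hp1.trans ?_
    calc _ ≤ Real.exp L * (Real.exp (-(6 * L)) * Real.exp (L * Real.exp 1)) := by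
          gcongr; exact ac_sum L
      _ ≤ Real.exp (-L) := by
        rw [← Real.exp_add, ← Real.exp_add, Real.exp_le_exp]
        have : Real.exp 1 ≤ 3 := by
          have := Real.exp_one_lt_d9; linarith
        have : L * Real.exp 1 ≤ L * (3 : ℝ) := by gcongr
        have hL : (0 : ℝ) ≤ L := Nat.cast_nonneg L
        linarith
      _ ≤ ε := by linarith
  · intro x hx
    have h1 := hpx x (hsub hx)
    have h2 := ac_val L (-x) (by linarith [hx.2])
    rw [neg_neg] at h2
    calc _ = |(p.eval x - Real.exp (L * x) * ∑' n, ac L n * x ^ n)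
          + (Real.exp (L * x) * ∑' n, ac L n * x ^ n + 1 / 2)| := by congr 1; ring
      _ ≤ _ := abs_add_le _ _
      _ ≤ ε := by linarith

lemma Sm.add {K : Set ℝ} {g h : ℝ → ℝ} (hg : Sm K g) (hh : Sm K h) :
    Sm K (fun x => g x + h x) := by
  intro ε hε
  obtain ⟨p, hp, hp1, hpx⟩ := hg (ε / 2) (by linarith)
  obtain ⟨q, hq, hq1, hqx⟩ := hh (ε / 2) (by linarith)
  refine ⟨p + q, hp.add hq, ?_, fun x hx => ?_⟩
  · rw [Polynomial.eval_add]; linarith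
  · rw [Polynomial.eval_add]
    calc _ = |(p.eval x - g x) + (q.eval x - h x)| := by congr 1; ring
      _ ≤ _ := abs_add_le _ _
      _ ≤ ε := by linarith [hpx x hx, hqx x hx]

lemma Sm.mul_poly {K : Set ℝ} (hK : IsCompact K) {g : ℝ → ℝ} (hg : Sm K g)
    {q : Polynomial ℝ} (hq : NNP q) : Sm K (fun x => g x * q.eval x) := by
  intro ε hε
  obtain ⟨B, hB⟩ := hK.exists_bound_of_continuousOn q.continuous.continuousOn
  have hq1 := hq.eval_one
  set M := |B| + q.eval 1 + 1 with hM
  have hM0 : 0 < M := by positivity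
  obtain ⟨p, hp, hp1, hpx⟩ := hg (ε / M) (by positivity)
  have hm : ε / M * M = ε := by field_simp
  have hd : 0 < ε / M := by positivity
  refine ⟨p * q, hp.mul hq, ?_, fun x hx => ?_⟩
  · rw [Polynomial.eval_mul]
    calc _ ≤ ε / M * M := by
          gcongr
          linarith [abs_nonneg B]
      _ = ε := hm
  · rw [Polynomial.eval_mul, ← sub_mul, abs_mul]
    have := (hB x hx).trans (le_abs_self B)
    rw [Real.norm_eq_abs] at this
    calc _ ≤ ε / M * M := by
          gcongr
          · exact hpx x hx
          · linarith
      _ = ε := hm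

lemma Sm.poly {K : Set ℝ} (hK : IsCompact K) (h : Sm K (fun _ => -(1 / 2)))
    (q : Polynomial ℝ) : Sm K (fun x => q.eval x) := by
  have h4 : Sm K (fun _ => (1 / 4 : ℝ)) := by
    intro ε hε
    obtain ⟨p, hp, hp1, hpx⟩ := h (min (ε / 2) (1 / 2)) (by positivity)
    have m1 := min_le_left (ε / 2) (1 / 2)
    have m2 := min_le_right (ε / 2) (1 / 2)
    refine ⟨p * p, hp.mul hp, ?_, fun x hx => ?_⟩
    · rw [Polynomial.eval_mul]
      nlinarith [hp.eval_one]
    · rw [Polynomial.eval_mul]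
      have h1 := hpx x hx
      have e : p.eval x * p.eval x - 1 / 4 = (p.eval x - -(1 / 2)) * (p.eval x - 1 / 2) := by ring
      have h2 : |p.eval x - 1 / 2| ≤ 3 / 2 := by
        rw [abs_le] at h1 ⊢
        constructor <;> linarith
      rw [e, abs_mul]
      calc _ ≤ ε / 2 * (3 / 2) := by
            gcongr
            exact h1.trans m1
        _ ≤ ε := by linarith
  induction q using Polynomial.induction_on' with
  | add p q hp hq => simpa only [Polynomial.eval_add] using hp.add hq
  | monomial n a =>
    rcases le_total 0 a with ha | ha
    · have := h4.mul_poly hK (NNP.monomial n (a := 4 * a) (by linarith))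
      convert this using 2 with x
      simp only [Polynomial.eval_monomial]; ring
    · have := h.mul_poly hK (NNP.monomial n (a := -(2 * a)) (by linarith))
      convert this using 2 with x
      simp only [Polynomial.eval_monomial]; ring

theorem convexPolynomials_dense_compact_open (a b : ℝ) (hab : a < b) (hb : b ≤ -1)
    (f : ℝ → ℝ) (hf : ContinuousOn f (Set.Ioo a b))
    (K : Set ℝ) (hK : IsCompact K) (hKsub : K ⊆ Set.Ioo a b)
    (ε : ℝ) (hε : 0 < ε) :
    ∃ p : Polynomial ℝ, IsConvexPolynomial p ∧ ∀ x ∈ K, |p.eval x - f x| < ε := by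
  rcases K.eq_empty_or_nonempty with rfl | hne
  · exact ⟨1, ⟨fun n => by rw [Polynomial.coeff_one]; split_ifs <;> norm_num, by simp⟩, by simp⟩
  obtain ⟨c, hcK, hc⟩ := hK.exists_isLeast hne
  obtain ⟨d, hdK, hd⟩ := hK.exists_isGreatest hne
  have hKI : K ⊆ Set.Icc c d := fun x hx => ⟨hc hx, hd hx⟩
  have hd1 : d < -1 := (hKsub hdK).2.trans_le hb
  have hcd : c ≤ d := hc hdK
  have hIs : Set.Icc c d ⊆ Set.Ioo a b := fun x hx =>
    ⟨(hKsub hcK).1.trans_le hx.1, hx.2.trans_lt (hKsub hdK).2⟩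
  obtain ⟨m, hm⟩ := pow_unbounded_of_one_lt 20 (show 1 < -d by linarith)
  set k := 2 * m + 1 with hk
  have hkodd : Odd k := ⟨m, rfl⟩
  have hdk : d ^ k ≤ -20 := by
    have h1 : (-d) ^ m ≤ (-d) ^ k := pow_le_pow_right₀ (by linarith) (by omega)
    rw [hkodd.neg_pow] at h1; linarith
  have hmono := hkodd.strictMono_pow (R := ℝ)
  have half : Sm K (fun _ => -(1 / 2)) := by
    intro η hη
    have hck : c ^ k ≤ d ^ k := hmono.monotone hcd
    obtain ⟨p, hp, hp1, hpx⟩ := sm_half (-c ^ k) (by linarith) η hη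
    refine ⟨Polynomial.expand ℝ k p, ?_, ?_, ?_⟩
    · intro n
      rw [Polynomial.coeff_expand (by omega)]
      split_ifs
      · exact hp _
      · exact le_rfl
    · rw [Polynomial.expand_eval, one_pow]; exact hp1
    · intro x hx
      rw [Polynomial.expand_eval]
      refine hpx _ ⟨?_, ?_⟩
      · rw [neg_neg]; exact hmono.monotone (hc hx)
      · exact (hmono.monotone (hd hx)).trans hdk
  obtain ⟨q, hq⟩ := exists_polynomial_near_of_continuousOn c d f (hf.mono hIs) (ε / 4) (by linarith)
  obtain ⟨p, hp, hp1, hpx⟩ := half.poly hK (q - 1) (min 1 (ε / 4)) (by positivity)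
  have m1 := min_le_left 1 (ε / 4)
  have m2 := min_le_right 1 (ε / 4)
  have hp0 := hp.eval_one
  refine ⟨p + Polynomial.monomial 0 (1 - p.eval 1),
    ⟨hp.add (NNP.monomial 0 (by linarith)), by simp⟩, fun x hx => ?_⟩
  have h1 := hpx x hx
  have h2 := hq x (hKI hx)
  simp only [Polynomial.eval_sub, Polynomial.eval_one] at h1
  simp only [Polynomial.eval_add, Polynomial.eval_monomial, pow_zero, mul_one]
  rw [abs_le] at h1
  rw [abs_lt] at h2 ⊢
  constructor <;> linarith
end

section
/- Let μ be a finite positive Borel measure on ℝ with compact support, and let M_x denote the bounded linear operator on the real Hilbert space L²_ℝ(μ) given by (M_x f)(x) = x·f(x). Then M_x is convex-cyclic (i.e., there exists g ∈ L²_ℝ(μ) such that the convex hull of the orbit {xⁿ·g : n ≥ 0} is dense in L²_ℝ(μ)) if and only if μ([-1,∞)) = 0. -/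
open MeasureTheory

lemma aux_hasSum_exp (x : ℝ) : HasSum (fun n : ℕ => x ^ n / (n.factorial : ℝ)) (Real.exp x) := by
  rw [Real.exp_eq_exp_ℝ]
  exact NormedSpace.expSeries_div_hasSum_exp x

/-- termwise integration of the exponential series -/
lemma aux_integral_exp (μ : Measure ℝ) (f y : ℝ → ℝ) (B : ℝ) (hf : Integrable f μ)
    (hy : Measurable y) (hB : ∀ᵐ x ∂μ, |y x| ≤ B) :
    HasSum (fun n : ℕ => (∫ x, y x ^ n * f x ∂μ) / (n.factorial : ℝ))
      (∫ x, Real.exp (y x) * f x ∂μ) := by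
  have hb : ∀ n : ℕ, ∀ᵐ x ∂μ, ‖y x ^ n / (n.factorial : ℝ)‖ ≤ B ^ n / (n.factorial : ℝ) := by
    intro n
    filter_upwards [hB] with x hx
    rw [norm_div, norm_pow, Real.norm_eq_abs, RCLike.norm_natCast]
    gcongr
  have hint : ∀ n : ℕ, Integrable (fun x => y x ^ n / (n.factorial : ℝ) * f x) μ := by
    intro n
    exact hf.bdd_mul ((hy.pow_const n).div_const _).aestronglyMeasurable (hb n)
  have key := hasSum_integral_of_summable_integral_norm hint (by
    refine Summable.of_nonneg_of_le (fun n => integral_nonneg fun x => norm_nonneg _) ?_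
      ((aux_hasSum_exp B).summable.mul_right (∫ x, ‖f x‖ ∂μ))
    intro n
    rw [← integral_const_mul]
    apply integral_mono_ae (hint n).norm (hf.norm.const_mul _)
    filter_upwards [hb n] with x hx
    rw [norm_mul]
    gcongr)
  have e1 : (fun n : ℕ => (∫ x, y x ^ n * f x ∂μ) / (n.factorial : ℝ)) =
      fun n : ℕ => ∫ x, y x ^ n / (n.factorial : ℝ) * f x ∂μ := by
    funext n
    rw [← integral_div]
    refine integral_congr_ae (Filter.Eventually.of_forall fun x => ?_)
    simp only
    ring
  have e2 : ∫ x, Real.exp (y x) * f x ∂μ =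
      ∫ x, ∑' n : ℕ, y x ^ n / (n.factorial : ℝ) * f x ∂μ := by
    refine integral_congr_ae (Filter.Eventually.of_forall fun x => ?_)
    simp only
    rw [tsum_mul_right, (aux_hasSum_exp (y x)).tsum_eq]
  rw [e1, e2]
  exact key

lemma aux_stirling (n : ℕ) : (n.factorial : ℝ) ≤ 3 * (n + 1) * (n / Real.exp 1) ^ n := by
  rcases n with _ | n
  · simp
  have h := Stirling.stirlingSeq'_antitone (Nat.zero_le n)
  simp only [Function.comp, Nat.succ_eq_add_one, zero_add, Stirling.stirlingSeq_one] at h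
  unfold Stirling.stirlingSeq at h
  set m := n + 1 with hm
  have hm0 : (1:ℝ) ≤ m := by rw [hm]; push_cast; linarith [(Nat.cast_nonneg n : (0:ℝ) ≤ n)]
  have hP : 0 < ((m:ℝ) / Real.exp 1) ^ m := by positivity
  rw [div_le_iff₀ (by positivity)] at h
  have e3 : Real.exp 1 < 3 := by linarith [Real.exp_one_lt_d9]
  rw [Real.sqrt_mul (by norm_num)] at h
  have h2 : (m.factorial : ℝ) ≤ Real.exp 1 * √m * ((m:ℝ) / Real.exp 1) ^ m := by
    refine h.trans (le_of_eq ?_)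
    have : √(2:ℝ) ≠ 0 := by positivity
    generalize ((m:ℝ) / Real.exp 1) ^ m = P
    field_simp
  refine h2.trans ?_
  have hs : √(m:ℝ) ≤ m + 1 := by
    rw [Real.sqrt_le_left (by positivity)]; nlinarith
  gcongr

/-- One-sided boundedness of moments gives linear two-sided bounds. -/
lemma aux_moment_bound (μ : Measure ℝ) (f : ℝ → ℝ) (R : ℝ) (hf : Integrable f μ)
    (hR : ∀ᵐ x ∂μ, |x| ≤ R) (hneg : ∀ᵐ x ∂μ, x < -1) (C : ℝ)
    (hC : ∀ n : ℕ, ∫ x, x ^ n * f x ∂μ ≤ C) :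
    ∃ K : ℝ, 0 ≤ K ∧ ∀ n : ℕ, |∫ x, x ^ n * f x ∂μ| ≤ K * (n + 1) := by
  set F := ∫ x, ‖f x‖ ∂μ with hF
  have hF0 : 0 ≤ F := integral_nonneg fun x => norm_nonneg _
  set D := |C| with hD
  have hD0 : 0 ≤ D := abs_nonneg _
  have hCD : ∀ n : ℕ, ∫ x, x ^ n * f x ∂μ ≤ D := fun n => (hC n).trans (le_abs_self C)
  have main : ∀ n : ℕ, ∀ s : ℝ, 0 ≤ s →
      (D - ∫ x, x ^ n * f x ∂μ) * (s ^ n / n.factorial) ≤ (D + F) * Real.exp s := by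
    intro n s hs
    have h1 := aux_integral_exp μ f (fun x => s * x) (s * R) hf (by fun_prop) (by
      filter_upwards [hR] with x hx
      rw [abs_mul, abs_of_nonneg hs]; gcongr)
    have h2 := ((aux_hasSum_exp s).mul_left D).sub h1
    have h3 : HasSum (fun n : ℕ => (D - ∫ x, x ^ n * f x ∂μ) * (s ^ n / n.factorial))
        (D * Real.exp s - ∫ x, Real.exp (s * x) * f x ∂μ) := by
      have e : (fun n : ℕ => (D - ∫ x, x ^ n * f x ∂μ) * (s ^ n / n.factorial)) =
          fun n : ℕ => D * (s ^ n / n.factorial) -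
            (∫ x, (s * x) ^ n * f x ∂μ) / (n.factorial : ℝ) := by
        funext n
        simp_rw [mul_pow, mul_assoc]
        rw [integral_const_mul]; ring
      rw [e]
      exact h2
    have h4 := le_hasSum h3 n (fun m _ => mul_nonneg (by linarith [hCD m]) (by positivity))
    refine h4.trans ?_
    have h5 : |∫ x, Real.exp (s * x) * f x ∂μ| ≤ F := by
      rw [← Real.norm_eq_abs]
      refine norm_integral_le_of_norm_le hf.norm ?_
      filter_upwards [hneg] with x hx
      rw [norm_mul]
      have : Real.exp (s * x) ≤ 1 := by
        rw [Real.exp_le_one_iff]; nlinarith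
      rw [Real.norm_of_nonneg (Real.exp_pos _).le]
      exact mul_le_of_le_one_left (norm_nonneg _) this
    have := (abs_le.1 h5).1
    have : 1 ≤ Real.exp s := Real.one_le_exp hs
    nlinarith
  refine ⟨D + 3 * (D + F), by positivity, fun n => ?_⟩
  have h1 := main n n (by positivity)
  have h2 := aux_stirling n
  have hn0 : (0:ℝ) ≤ n := Nat.cast_nonneg n
  have h3 : (D - ∫ x, x ^ n * f x ∂μ) ≤ (D + F) * (3 * (n + 1)) := by
    have hp : (0:ℝ) < (n:ℝ) ^ n := by
      rcases n with _ | n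
      · simp
      · positivity
    have he : Real.exp (n:ℝ) = Real.exp 1 ^ n := by
      rw [← Real.exp_nat_mul]; simp
    rw [div_pow, ← he] at h2
    have hfac : (0:ℝ) < n.factorial := by positivity
    have hE : 0 < Real.exp (n:ℝ) := Real.exp_pos _
    have h4 : (D - ∫ x, x ^ n * f x ∂μ) ≤ (D + F) * Real.exp n * (n.factorial / (n:ℝ) ^ n) := by
      rw [← mul_div_assoc, le_div_iff₀ hp]
      rw [← mul_div_assoc, div_le_iff₀ hfac] at h1
      exact h1
    refine h4.trans ?_
    rw [mul_assoc]
    refine mul_le_mul_of_nonneg_left ?_ (by positivity)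
    rw [← mul_div_assoc, div_le_iff₀ hp]
    rw [← mul_div_assoc, le_div_iff₀ hE] at h2
    linarith
  have := hCD n
  rw [abs_le]
  constructor <;> nlinarith

lemma aux_laplace_bound (μ : Measure ℝ) (f : ℝ → ℝ) (R : ℝ) (hf : Integrable f μ)
    (hR : ∀ᵐ x ∂μ, |x| ≤ R) (K : ℝ) (hK0 : 0 ≤ K)
    (hK : ∀ n : ℕ, |∫ x, x ^ n * f x ∂μ| ≤ K * (n + 1)) (ρ : ℝ) (hρ : 1 < ρ) :
    ∃ L : ℝ, 0 ≤ L ∧ ∀ s : ℝ, 0 ≤ s → |∫ x, Real.exp (-s * x) * f x ∂μ| ≤ L * Real.exp (ρ * s) := by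
  have hd : 0 < ρ - 1 := by linarith
  refine ⟨K * (1 + 1 / (ρ - 1)), by positivity, fun s hs => ?_⟩
  have h1 := aux_integral_exp μ f (fun x => -s * x) (s * R) hf (by fun_prop) (by
      filter_upwards [hR] with x hx
      rw [abs_mul, abs_neg, abs_of_nonneg hs]; gcongr)
  have h2 := (aux_hasSum_exp (ρ * s)).mul_left (K * (1 + 1 / (ρ - 1)))
  rw [← h1.tsum_eq, ← Real.norm_eq_abs]
  refine tsum_of_norm_bounded h2 fun n => ?_
  simp_rw [mul_pow, mul_assoc]
  rw [integral_const_mul, norm_div, norm_mul, norm_pow, norm_neg, RCLike.norm_natCast,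
    Real.norm_of_nonneg hs, ← mul_div_assoc, ← mul_div_assoc]
  refine div_le_div_of_nonneg_right ?_ (by positivity)
  rw [Real.norm_eq_abs]
  have hb : ((n:ℝ) + 1) ≤ (1 + 1 / (ρ - 1)) * ρ ^ n := by
    have := one_add_mul_le_pow (a := ρ - 1) (by linarith) n
    rw [show 1 + (ρ - 1) = ρ by ring] at this
    have h0 : (0:ℝ) ≤ n := Nat.cast_nonneg n
    have : (1 + 1 / (ρ - 1)) * (1 + n * (ρ - 1)) ≤ (1 + 1 / (ρ - 1)) * ρ ^ n := by gcongr
    refine le_trans ?_ this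
    have e : (1 + 1 / (ρ - 1)) * (1 + n * (ρ - 1)) = 1 + n + n * (ρ - 1) + 1 / (ρ - 1) := by
      field_simp; ring
    rw [e]
    have : 0 ≤ n * (ρ - 1) := by positivity
    have : 0 ≤ 1 / (ρ - 1) := by positivity
    linarith
  calc s ^ n * |∫ x, x ^ n * f x ∂μ| ≤ s ^ n * (K * (n + 1)) := by gcongr; exact hK n
    _ ≤ s ^ n * (K * ((1 + 1 / (ρ - 1)) * ρ ^ n)) := by gcongr
    _ = _ := by ring

lemma aux_limit (μ : Measure ℝ) (f : ℝ → ℝ) (R : ℝ) (hf : Integrable f μ)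
    (hR : ∀ᵐ x ∂μ, |x| ≤ R) (K : ℝ) (hK0 : 0 ≤ K)
    (hK : ∀ n : ℕ, |∫ x, x ^ n * f x ∂μ| ≤ K * (n + 1)) (q : ℝ) (hq : q < -1) (c : ℝ) (hc : 0 < c) :
    (∫ x in Set.Iio q, f x ∂μ) + (1 - Real.exp (-c)) * ∫ x in {q}, f x ∂μ = 0 := by
  obtain ⟨ρ, hρ1, hρ2⟩ := exists_between (show 1 < -q by linarith)
  obtain ⟨L, hL0, hL⟩ := aux_laplace_bound μ f R hf hR K hK0 hK ρ hρ1
  -- the test functions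
  let y : ℕ → ℝ → ℝ := fun k x => -c * Real.exp (k * (q - x))
  have hym : ∀ k, Measurable (y k) := fun k => by fun_prop
  have hle : ∀ k x, Real.exp (y k x) ≤ 1 := by
    intro k x
    rw [Real.exp_le_one_iff]
    have := Real.exp_pos (k * (q - x))
    simp only [y]; nlinarith
  have hpow : ∀ k n : ℕ, |∫ x, y k x ^ n * f x ∂μ| ≤ L * (c * Real.exp (k * (ρ + q))) ^ n := by
    intro k n
    have e : ∀ x, y k x ^ n * f x = ((-c) ^ n * Real.exp (n * k * q)) *
        (Real.exp (-((n:ℝ) * k) * x) * f x) := by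
      intro x
      simp only [y]
      rw [mul_pow, ← Real.exp_nat_mul, show (n:ℝ) * (k * (q - x)) = n * k * q + -(n * k) * x by ring,
        Real.exp_add]
      ring
    simp_rw [e]
    rw [integral_const_mul, abs_mul, abs_mul, abs_pow, abs_neg, abs_of_pos hc,
      abs_of_pos (Real.exp_pos _)]
    refine (mul_le_mul_of_nonneg_left (hL (n * k) (by positivity)) (by positivity)).trans
      (le_of_eq ?_)
    rw [mul_pow, ← Real.exp_nat_mul, show (n:ℝ) * (k * (ρ + q)) = n * k * q + ρ * (n * k) by ring,
        Real.exp_add]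
    ring
  have hbd : ∀ k : ℕ, |(∫ x, Real.exp (y k x) * f x ∂μ) - ∫ x, f x ∂μ| ≤
      L * (Real.exp (c * Real.exp (k * (ρ + q))) - 1) := by
    intro k
    have h1 := aux_integral_exp μ f (y k) (c * Real.exp (k * (|q| + R))) hf (hym k) (by
      filter_upwards [hR] with x hx
      simp only [y]
      rw [abs_mul, abs_neg, abs_of_pos hc, abs_of_pos (Real.exp_pos _)]
      gcongr
      linarith [le_abs_self q, (abs_le.1 hx).1])
    have h2 := (aux_hasSum_exp (c * Real.exp (k * (ρ + q)))).mul_left L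
    have h1' := (hasSum_nat_add_iff' 1).2 h1
    have h2' := (hasSum_nat_add_iff' 1).2 h2
    simp only [Finset.sum_range_one, pow_zero, one_mul, Nat.factorial_zero, Nat.cast_one, div_one,
      mul_one] at h1' h2'
    rw [← h1'.tsum_eq, ← Real.norm_eq_abs, mul_sub, mul_one]
    refine tsum_of_norm_bounded h2' fun n => ?_
    rw [norm_div, RCLike.norm_natCast, ← mul_div_assoc]
    gcongr
    exact hpow k (n + 1)
  have hz : Filter.Tendsto (fun k : ℕ => L * (Real.exp (c * Real.exp (k * (ρ + q))) - 1))
      Filter.atTop (nhds 0) := by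
    have h0 : Filter.Tendsto (fun k : ℕ => Real.exp (k * (ρ + q))) Filter.atTop (nhds 0) := by
      refine Real.tendsto_exp_atBot.comp ?_
      exact (tendsto_natCast_atTop_atTop).atTop_mul_const_of_neg (by linarith)
    have h1 := ((Real.continuous_exp.tendsto _).comp (h0.const_mul c)).sub_const 1 |>.const_mul L
    simpa using h1
  have hlim1 : Filter.Tendsto (fun k : ℕ => ∫ x, Real.exp (y k x) * f x ∂μ) Filter.atTop
      (nhds (∫ x, f x ∂μ)) := by
    rw [tendsto_iff_norm_sub_tendsto_zero]
    exact squeeze_zero (fun _ => norm_nonneg _) hbd hz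
  have hlim2 : Filter.Tendsto (fun k : ℕ => ∫ x, Real.exp (y k x) * f x ∂μ) Filter.atTop
      (nhds (∫ x, (f x - ((Set.Iio q).indicator f x +
        (1 - Real.exp (-c)) * ({q} : Set ℝ).indicator f x)) ∂μ)) := by
    refine tendsto_integral_of_dominated_convergence (fun x => ‖f x‖) ?_ hf.norm ?_ ?_
    · intro k
      exact ((hym k).exp.aestronglyMeasurable).mul hf.aestronglyMeasurable
    · intro k
      refine Filter.Eventually.of_forall fun x => ?_
      rw [norm_mul, Real.norm_of_nonneg (Real.exp_pos _).le]
      exact mul_le_of_le_one_left (norm_nonneg _) (hle k x)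
    · refine Filter.Eventually.of_forall fun x => ?_
      rcases lt_trichotomy x q with h | h | h
      · have h0 : Filter.Tendsto (fun k : ℕ => Real.exp (y k x)) Filter.atTop (nhds 0) := by
          refine Real.tendsto_exp_atBot.comp ?_
          refine Filter.Tendsto.const_mul_atTop_of_neg (by linarith) ?_
          refine Real.tendsto_exp_atTop.comp ?_
          exact (tendsto_natCast_atTop_atTop).atTop_mul_const (by linarith)
        have := h0.mul_const (f x)
        simpa [h, h.ne] using this
      · subst h
        have e : ∀ k : ℕ, Real.exp (y k x) * f x = f x - ((Set.Iio x).indicator f x +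
            (1 - Real.exp (-c)) * ({x} : Set ℝ).indicator f x) := by
          intro k
          simp [y]
          ring
        simp_rw [e]
        exact tendsto_const_nhds
      · have h0 : Filter.Tendsto (fun k : ℕ => Real.exp (k * (q - x))) Filter.atTop (nhds 0) := by
          refine Real.tendsto_exp_atBot.comp ?_
          exact (tendsto_natCast_atTop_atTop).atTop_mul_const_of_neg (by linarith)
        have h1 := ((Real.continuous_exp.tendsto _).comp (h0.const_mul (-c))).mul_const (f x)
        simpa [y, h.le, h.ne', Function.comp_def] using h1
  have heq := tendsto_nhds_unique hlim1 hlim2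
  have i1 : Integrable ((Set.Iio q).indicator f) μ := hf.indicator measurableSet_Iio
  have i2 : Integrable (fun x => (1 - Real.exp (-c)) * ({q} : Set ℝ).indicator f x) μ :=
    (hf.indicator (measurableSet_singleton q)).const_mul _
  have i3 : Integrable (fun x => (Set.Iio q).indicator f x +
      (1 - Real.exp (-c)) * ({q} : Set ℝ).indicator f x) μ := i1.add i2
  rw [integral_sub hf i3, integral_add i1 i2, integral_const_mul,
    integral_indicator measurableSet_Iio, integral_indicator (measurableSet_singleton q)] at heq
  linarith

lemma aux_zero (μ : Measure ℝ) (f : ℝ → ℝ) (R : ℝ) (hf : Integrable f μ)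
    (hR : ∀ᵐ x ∂μ, |x| ≤ R) (hneg : ∀ᵐ x ∂μ, x < -1) (C : ℝ)
    (hC : ∀ n : ℕ, ∫ x, x ^ n * f x ∂μ ≤ C) : f =ᵐ[μ] 0 := by
  obtain ⟨K, hK0, hK⟩ := aux_moment_bound μ f R hf hR hneg C hC
  have h1 : ∀ q < -1, ∫ x in Set.Iio q, f x ∂μ = 0 := by
    intro q hq
    have e1 := aux_limit μ f R hf hR K hK0 hK q hq 1 one_pos
    have e2 := aux_limit μ f R hf hR K hK0 hK q hq 2 two_pos
    have hlt : Real.exp (-2) < Real.exp (-1) := by rw [Real.exp_lt_exp]; norm_num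
    have : (Real.exp (-1) - Real.exp (-2)) * ∫ x in {q}, f x ∂μ = 0 := by linarith
    rcases mul_eq_zero.1 this with h | h
    · linarith
    · rw [h] at e1; linarith
  have h2 : ∫ x, f x ∂μ = 0 := by
    have hmono : Monotone (fun n : ℕ => Set.Iio (-1 - 1 / ((n:ℝ) + 1))) := by
      intro a b hab
      apply Set.Iio_subset_Iio
      have := one_div_le_one_div_of_le (show (0:ℝ) < a + 1 by positivity)
        (show (a:ℝ) + 1 ≤ b + 1 by gcongr)
      linarith
    have ht := tendsto_setIntegral_of_monotone (μ := μ) (f := f)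
      (fun n : ℕ => (measurableSet_Iio : MeasurableSet (Set.Iio (-1 - 1 / ((n:ℝ) + 1))))) hmono
      hf.integrableOn
    have hz : ∀ n : ℕ, ∫ x in Set.Iio (-1 - 1 / ((n:ℝ) + 1)), f x ∂μ = 0 := by
      intro n
      apply h1
      have : 0 < 1 / ((n:ℝ) + 1) := by positivity
      linarith
    simp_rw [hz] at ht
    have h0 := tendsto_nhds_unique ht tendsto_const_nhds
    rw [← h0, Measure.restrict_eq_self_of_ae_mem]
    filter_upwards [hneg] with x hx
    obtain ⟨n, hn⟩ := exists_nat_one_div_lt (show 0 < -1 - x by linarith)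
    exact Set.mem_iUnion.2 ⟨n, by simp only [Set.mem_Iio]; linarith⟩
  refine hf.ae_eq_zero_of_forall_setIntegral_eq_zero fun s hs _ => ?_
  refine MeasurableSpace.induction_on_inter (C := fun s _ => ∫ x in s, f x ∂μ = 0)
    ((BorelSpace.measurable_eq (α := ℝ)).trans (borel_eq_generateFrom_Iio ℝ)) isPiSystem_Iio
    ?_ ?_ ?_ ?_ s hs
  · simp
  · rintro _ ⟨q, rfl⟩
    rcases lt_or_ge q (-1) with hq | hq
    · exact h1 q hq
    · rw [Measure.restrict_eq_self_of_ae_mem, h2]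
      filter_upwards [hneg] with x hx
      exact lt_of_lt_of_le hx hq
  · intro t ht h
    have := integral_add_compl ht hf
    linarith
  · intro g hd hm h
    rw [integral_iUnion hm hd hf.integrableOn]
    simp [h]

lemma aux_forward (μ : Measure ℝ) [IsFiniteMeasure μ] (g : Lp ℝ 2 μ)
    (hd : Dense (convexHull ℝ
      {h : Lp ℝ 2 μ | ∃ n : ℕ, (h : ℝ → ℝ) =ᵐ[μ] fun x => x ^ n * (g : ℝ → ℝ) x})) :
    μ (Set.Ici (-1 : ℝ)) = 0 := by
  set A := Set.Ici (-1 : ℝ) with hA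
  have hAm : MeasurableSet A := measurableSet_Ici
  have hgm : MemLp (A.indicator (g : ℝ → ℝ)) 2 μ := (Lp.memLp g).indicator hAm
  set v : Lp ℝ 2 μ := hgm.toLp _ with hv
  have hvc : (v : ℝ → ℝ) =ᵐ[μ] A.indicator (g : ℝ → ℝ) := hgm.coeFn_toLp
  have step1 : ∀ h : Lp ℝ 2 μ, -(inner ℝ v v) ≤ inner ℝ v h := by
    have hcl : IsClosed {h : Lp ℝ 2 μ | -(inner ℝ v v) ≤ inner ℝ v h} :=
      isClosed_le continuous_const (by fun_prop)
    have hcv : Convex ℝ {h : Lp ℝ 2 μ | -(inner ℝ v v) ≤ inner ℝ v h} :=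
      convex_halfSpace_ge (innerSL ℝ v).toLinearMap.isLinear _
    have hsub := convexHull_min (s := {h : Lp ℝ 2 μ | ∃ n : ℕ, (h : ℝ → ℝ) =ᵐ[μ] fun x => x ^ n * (g : ℝ → ℝ) x}) (t := {h : Lp ℝ 2 μ | -(inner ℝ v v) ≤ inner ℝ v h}) (by
      rintro h ⟨n, hn⟩
      simp only [Set.mem_ofPred_eq]
      rw [L2.inner_def, L2.inner_def, ← integral_neg]
      refine integral_mono_ae (L2.integrable_inner v v).neg (L2.integrable_inner v h) ?_
      filter_upwards [hn, hvc] with x h1 h2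
      simp only [Pi.neg_apply, h1, h2, RCLike.inner_apply, conj_trivial]
      by_cases hx : x ∈ A
      · simp only [Set.indicator_of_mem hx]
        have hp : -1 ≤ x ^ n := by
          rcases le_total 0 x with h0 | h0
          · linarith [pow_nonneg h0 n]
          · have : |x ^ n| ≤ 1 := by
              rw [abs_pow]
              exact pow_le_one₀ (abs_nonneg _) (abs_le.2 ⟨hx, by linarith⟩)
            exact (abs_le.1 this).1
        nlinarith [mul_self_nonneg ((g : ℝ → ℝ) x)]
      · simp [Set.indicator_of_notMem hx]) hcv
    intro h
    exact hcl.closure_subset_iff.2 hsub (hd h)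
  have hv0 : v = 0 := by
    have := step1 (-(2:ℝ) • v)
    rw [inner_smul_right] at this
    have h0 : 0 ≤ inner ℝ v v := real_inner_self_nonneg
    exact inner_self_eq_zero.1 (show inner ℝ v v = 0 by linarith)
  have hg0 : A.indicator (g : ℝ → ℝ) =ᵐ[μ] 0 := by
    refine hvc.symm.trans ?_
    rw [hv0]; exact Lp.coeFn_zero _ _ _
  set w : Lp ℝ 2 μ := indicatorConstLp 2 hAm (measure_ne_top μ A) (1:ℝ) with hw
  have step2 : ∀ h : Lp ℝ 2 μ, inner ℝ w h = 0 := by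
    have hcl : IsClosed {h : Lp ℝ 2 μ | inner ℝ w h = 0} :=
      isClosed_eq (by fun_prop) continuous_const
    have hcv : Convex ℝ {h : Lp ℝ 2 μ | inner ℝ w h = 0} :=
      convex_hyperplane (innerSL ℝ w).toLinearMap.isLinear _
    have hsub := convexHull_min (s := {h : Lp ℝ 2 μ | ∃ n : ℕ, (h : ℝ → ℝ) =ᵐ[μ] fun x => x ^ n * (g : ℝ → ℝ) x}) (t := {h : Lp ℝ 2 μ | inner ℝ w h = 0}) (by
      rintro h ⟨n, hn⟩
      simp only [Set.mem_ofPred_eq]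
      rw [hw, L2.inner_indicatorConstLp_one, ← integral_indicator hAm]
      refine integral_eq_zero_of_ae ?_
      filter_upwards [hn, hg0] with x h1 h2
      by_cases hx : x ∈ A
      · simp only [Set.indicator_of_mem hx] at h2 ⊢
        rw [h1, h2]; simp
      · simp [Set.indicator_of_notMem hx]) hcv
    intro h
    exact hcl.closure_subset_iff.2 hsub (hd h)
  have hw0 := step2 w
  rw [hw, L2.inner_indicatorConstLp_one] at hw0
  have h3 : ∫ x in A, (indicatorConstLp 2 hAm (measure_ne_top μ A) (1:ℝ) : ℝ → ℝ) x ∂μ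
      = ∫ x in A, (1:ℝ) ∂μ := by
    refine setIntegral_congr_ae hAm ?_
    filter_upwards [indicatorConstLp_coeFn (p := 2) (hs := hAm) (hμs := measure_ne_top μ A) (c := (1:ℝ))] with x h1 hx
    rw [h1, Set.indicator_of_mem hx]
  rw [h3] at hw0
  simpa [Measure.real, ENNReal.toReal_eq_zero_iff] using hw0

theorem multiplication_operator_convexCyclic_iff (μ : Measure ℝ) [IsFiniteMeasure μ]
    (hsupp : ∃ K : Set ℝ, IsCompact K ∧ μ Kᶜ = 0) :
    (∃ g : Lp ℝ 2 μ, Dense (convexHull ℝ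
      {h : Lp ℝ 2 μ | ∃ n : ℕ, (h : ℝ → ℝ) =ᵐ[μ] fun x => x ^ n * (g : ℝ → ℝ) x}))
    ↔ μ (Set.Ici (-1 : ℝ)) = 0 := by
  constructor
  · rintro ⟨g, hg⟩
    exact aux_forward μ g hg
  intro hμ
  obtain ⟨K, hK, hKμ⟩ := hsupp
  obtain ⟨R, hRK⟩ := hK.isBounded.exists_norm_le
  have hR : ∀ᵐ x ∂μ, |x| ≤ R := by
    have : ∀ᵐ x ∂μ, x ∈ K := hKμ
    filter_upwards [this] with x hx using hRK x hx
  have hneg : ∀ᵐ x ∂μ, x < -1 := by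
    have : ∀ᵐ x ∂μ, x ∉ Set.Ici (-1:ℝ) := measure_eq_zero_iff_ae_notMem.1 hμ
    filter_upwards [this] with x hx
    simpa using hx
  have hm : ∀ n : ℕ, MemLp (fun x : ℝ => x ^ n) 2 μ := by
    intro n
    refine MemLp.of_bound (by fun_prop) (R ^ n) ?_
    filter_upwards [hR] with x hx
    rw [norm_pow, Real.norm_eq_abs]; gcongr
  refine ⟨(hm 0).toLp _, ?_⟩
  set S := {h : Lp ℝ 2 μ | ∃ n : ℕ, (h : ℝ → ℝ) =ᵐ[μ]
    fun x => x ^ n * (((hm 0).toLp _ : Lp ℝ 2 μ) : ℝ → ℝ) x} with hS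
  by_contra hnd
  have : ∃ z, z ∉ closure (convexHull ℝ S) := by
    by_contra hcon
    push Not at hcon
    exact hnd hcon
  obtain ⟨z, hz⟩ := this
  obtain ⟨φ, u, h1, h2⟩ := geometric_hahn_banach_closed_point (convex_convexHull ℝ S).closure
    isClosed_closure hz
  set f : Lp ℝ 2 μ := (InnerProductSpace.toDual ℝ (Lp ℝ 2 μ)).symm φ with hfdef
  have hφ : ∀ h, φ h = inner ℝ f h := fun h => by
    rw [hfdef, InnerProductSpace.toDual_symm_apply]
  have hmem : ∀ n : ℕ, (hm n).toLp _ ∈ S := by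
    intro n
    refine ⟨n, ?_⟩
    filter_upwards [(hm n).coeFn_toLp, (hm 0).coeFn_toLp] with x e1 e2
    rw [e1, e2]; simp
  have hmom : ∀ n : ℕ, φ ((hm n).toLp _) < u := fun n =>
    h1 _ (subset_closure (subset_convexHull ℝ S (hmem n)))
  have hval : ∀ n : ℕ, φ ((hm n).toLp _) = ∫ x, x ^ n * (f : ℝ → ℝ) x ∂μ := by
    intro n
    rw [hφ, L2.inner_def]
    refine integral_congr_ae ?_
    filter_upwards [(hm n).coeFn_toLp] with x e1
    rw [e1]; simp
  have hfi : Integrable (f : ℝ → ℝ) μ := (Lp.memLp f).integrable one_le_two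
  have hf0 := aux_zero μ f R hfi hR hneg u (fun n => by rw [← hval]; exact (hmom n).le)
  have hf00 : f = 0 := (Lp.eq_zero_iff_ae_eq_zero).2 hf0
  have a := hmom 0
  rw [hφ, hf00, inner_zero_left] at a
  rw [hφ, hf00, inner_zero_left] at h2
  linarith
end
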